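/- There exists a constant c > 0 such that for every integer a ≥ 8 for which the ring of integers of the simplest cubic field K_a equals ℤ[ρ], and for every real number x ≥ 125·a, one has P_p(a, x) ≥ c·(x/a)^(2/3). -/

import Mathlib

open NumberField

/-- The largest real root of `X³ - aX² - (a+3)X - 1` (for `a ≥ 7` this set of real roots
is nonempty and bounded above, so `sSup` picks out the largest root). -/
noncomputable def simplestCubicRoot (a : ℤ) : ℝ :=
  sSup {x : ℝ | x ^ 3 - (a : ℝ) * x ^ 2 - ((a : ℝ) + 3) * x - 1 = 0}

open Polynomial in
theorem simplestCubic_irreducible {a : ℤ} (ha : 0 ≤ a) :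
    (X ^ 3 - C a * X ^ 2 - C (a + 3) * X - 1 : ℤ[X]).Monic ∧
    (X ^ 3 - C a * X ^ 2 - C (a + 3) * X - 1 : ℤ[X]).natDegree = 3 ∧
    Irreducible (X ^ 3 - C a * X ^ 2 - C (a + 3) * X - 1 : ℤ[X]) := by
  have hdeg : (X ^ 3 - C a * X ^ 2 - C (a + 3) * X - 1 : ℤ[X]).natDegree = 3 := by
    compute_degree!
  have hmonic : (X ^ 3 - C a * X ^ 2 - C (a + 3) * X - 1 : ℤ[X]).Monic := by
    monicity!
  refine ⟨hmonic, hdeg, ?_⟩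
  rw [hmonic.irreducible_iff_roots_eq_zero_of_degree_le_three (by omega) (by omega)]
  refine Multiset.eq_zero_of_forall_notMem fun z hz => ?_
  rw [mem_roots hmonic.ne_zero, IsRoot.def] at hz
  simp only [eval_sub, eval_mul, eval_pow, eval_X, eval_C, eval_one] at hz
  have hunit : IsUnit z := IsUnit.of_mul_eq_one (z ^ 2 - a * z - (a + 3)) (by linarith)
  rcases Int.isUnit_iff.1 hunit with rfl | rfl <;> linarith

theorem simplestCubicRoot_isRoot {a : ℤ} (ha : 0 ≤ a) :
    simplestCubicRoot a ^ 3 - (a : ℝ) * simplestCubicRoot a ^ 2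
      - ((a : ℝ) + 3) * simplestCubicRoot a - 1 = 0 := by
  have ha' : (0 : ℝ) ≤ a := by exact_mod_cast ha
  set f : ℝ → ℝ := fun x => x ^ 3 - (a : ℝ) * x ^ 2 - ((a : ℝ) + 3) * x - 1 with hf
  have hcont : Continuous f := by fun_prop
  have hclosed : IsClosed {x : ℝ | f x = 0} := isClosed_eq hcont continuous_const
  have hne : {x : ℝ | f x = 0}.Nonempty := by
    have h := intermediate_value_Icc (show (0 : ℝ) ≤ a + 2 by linarith) hcont.continuousOn
    obtain ⟨x, -, hx⟩ := h (show (0 : ℝ) ∈ Set.Icc (f 0) (f (a + 2)) by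
      constructor <;> simp only [hf] <;> nlinarith)
    exact ⟨x, hx⟩
  have hbdd : BddAbove {x : ℝ | f x = 0} := by
    refine ⟨a + 2, fun x hx => ?_⟩
    by_contra! hlt
    simp only [hf, Set.mem_ofPred_eq] at hx
    nlinarith [mul_pos (show (0 : ℝ) < x by linarith) (show 0 < x - (a + 2) by linarith),
      mul_pos (mul_pos (show (0 : ℝ) < x by linarith) (show (0 : ℝ) < x by linarith))
        (show 0 < x - (a + 2) by linarith)]
  exact hclosed.csSup_mem hne hbdd

theorem simplestCubic_norm {R : Type*} [CommRing R] {a : ℤ} {θ : R}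
    (hθ : θ ^ 3 = a * θ ^ 2 + (a + 3) * θ + 1)
    (b : Module.Basis (Fin 3) ℤ R) (hb : ∀ i, b i = θ ^ (i : ℕ)) (u v : ℤ) :
    Algebra.norm ℤ ((u : R) + v * θ) =
      u ^ 3 - 3 * u * v ^ 2 + v ^ 3 + a * (u * v * (u - v)) := by
  have h0 : ((u : R) + v * θ) * b 0 = u • b 0 + v • b 1 := by
    simp [hb]
  have h1 : ((u : R) + v * θ) * b 1 = u • b 1 + v • b 2 := by
    simp [hb]; ring
  have h2 : ((u : R) + v * θ) * b 2 = v • b 0 + (v * (a + 3)) • b 1 + (u + v * a) • b 2 := by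
    simp [hb]; linear_combination (v : R) * hθ
  rw [Algebra.norm_eq_matrix_det b, Matrix.det_fin_three]
  simp only [Algebra.leftMulMatrix_eq_repr_mul, h0, h1, h2, map_add, map_smul,
    Module.Basis.repr_self, Finsupp.add_apply, Finsupp.smul_apply, Finsupp.single_apply]
  simp
  ring

theorem exists_simplestCubic_basis {a : ℤ} (ha : 0 ≤ a) {K : Type*} [Field K] [NumberField K]
    (σ : K →+* ℝ) {ρ : K}
    (hσ : σ ρ = simplestCubicRoot a)
    (hadj : Algebra.adjoin ℤ {ρ} = integralClosure ℤ K) :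
    ∃ (θ : 𝓞 K) (b : Module.Basis (Fin 3) ℤ (𝓞 K)),
      θ ^ 3 = a * θ ^ 2 + (a + 3) * θ + 1 ∧ ∀ i, b i = θ ^ (i : ℕ) := by
  have hρ : ρ ^ 3 = a * ρ ^ 2 + (a + 3) * ρ + 1 := by
    apply σ.injective
    have := simplestCubicRoot_isRoot ha
    simp only [map_add, map_mul, map_pow, map_intCast, map_ofNat, map_one, hσ]
    linarith
  have hmem : ρ ∈ integralClosure ℤ K := hadj ▸ Algebra.self_mem_adjoin_singleton ℤ ρ
  let θ : 𝓞 K := ⟨ρ, hmem⟩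
  have hθρ : algebraMap (𝓞 K) K θ = ρ := rfl
  have hθ : θ ^ 3 = a * θ ^ 2 + (a + 3) * θ + 1 := by
    apply FaithfulSMul.algebraMap_injective (𝓞 K) K
    simpa [hθρ, map_ofNat (algebraMap (𝓞 K) K) 3] using hρ
  have htop : Algebra.adjoin ℤ {θ} = ⊤ := by
    refine Subalgebra.map_injective (f := IsScalarTower.toAlgHom ℤ (𝓞 K) K)
      (FaithfulSMul.algebraMap_injective (𝓞 K) K) ?_
    rw [AlgHom.map_adjoin_singleton, Algebra.map_top]
    refine hadj.trans ?_
    ext y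
    exact ⟨fun hy => ⟨⟨y, hy⟩, rfl⟩, fun ⟨z, hz⟩ => hz ▸ z.2⟩
  have hint : IsIntegral ℤ θ := RingOfIntegers.isIntegral θ
  obtain ⟨hmonic, hdeg, hirr⟩ := simplestCubic_irreducible ha
  have hmin : (minpoly ℤ θ).natDegree = 3 := by
    have hdvd := minpoly.isIntegrallyClosed_dvd hint
      (p := (Polynomial.X ^ 3 - Polynomial.C a * Polynomial.X ^ 2
        - Polynomial.C (a + 3) * Polynomial.X - 1)) (by
        simp [map_ofNat (Polynomial.aeval θ) 3]; linear_combination hθ)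
    have hass := (minpoly.irreducible hint).associated_of_dvd hirr hdvd
    rw [Polynomial.eq_of_monic_of_associated (minpoly.monic hint) hmonic hass, hdeg]
  let pb := PowerBasis.ofAdjoinEqTop' hint htop
  refine ⟨θ, pb.basis.reindex (finCongr (by rw [← hmin]; rfl)), hθ, fun i => ?_⟩
  rw [Module.Basis.reindex_apply, PowerBasis.basis_eq_pow, PowerBasis.ofAdjoinEqTop'_gen]
  rfl

theorem card_coprime_odd_even_ge (M N : ℕ) :
    N ^ 2 ≤ 6 * (((Finset.Ico M (M + N)) ×ˢ (Finset.Ioc 0 N)).filter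
      fun q => (2 * q.1 + 1).Coprime (2 * q.2)).card := by
  classical
  set S := (Finset.Ico M (M + N)) ×ˢ (Finset.Ioc 0 N) with hS
  have hcard : S.card = N ^ 2 := by simp [hS, sq]
  have hsplit := Finset.card_filter_add_card_filter_not (s := S)
    (fun q : ℕ × ℕ => (2 * q.1 + 1).Coprime (2 * q.2))
  set bad := S.filter (fun q => ¬ (2 * q.1 + 1).Coprime (2 * q.2)) with hbad
  have hsub : bad ⊆ (Finset.Ioc 2 N).biUnion fun d =>
      ((Finset.Ico M (M + N)).filter fun i => i ≡ d / 2 [MOD d]) ×ˢ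
        ((Finset.Ioc 0 N).filter fun j => d ∣ j) := by
    rintro ⟨i, j⟩ h
    simp only [hbad, hS, Finset.mem_filter, Finset.mem_product, Nat.Prime.not_coprime_iff_dvd] at h
    obtain ⟨⟨hi, hj⟩, p, hp, hpi, hpj⟩ := h
    have hp2 : p ≠ 2 := by rintro rfl; omega
    have hodd : p % 2 = 1 := hp.eq_two_or_odd.resolve_left hp2
    have hcop : p.Coprime 2 := (Nat.coprime_primes hp Nat.prime_two).2 hp2
    have hpj' : p ∣ j := hcop.dvd_of_dvd_mul_left hpj
    rw [Finset.mem_Ioc] at hj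
    have hpN : p ≤ N := (Nat.le_of_dvd hj.1 hpj').trans hj.2
    have hp3 : 2 < p := by have := hp.two_le; omega
    simp only [Finset.mem_biUnion, Finset.mem_Ioc, Finset.mem_product, Finset.mem_filter]
    refine ⟨p, ⟨hp3, hpN⟩, ⟨hi, ?_⟩, hj, hpj'⟩
    refine Nat.ModEq.cancel_left_of_coprime hcop (c := 2) ?_
    refine Nat.ModEq.add_right_cancel' 1 ?_
    have h2 : 2 * (p / 2) + 1 = p := by omega
    rw [h2]
    exact ((Nat.modEq_zero_iff_dvd.2 hpi).trans (Nat.modEq_zero_iff_dvd.2 dvd_rfl).symm)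
  have hterm : ∀ d ∈ Finset.Ioc 2 N,
      (((((Finset.Ico M (M + N)).filter fun i => i ≡ d / 2 [MOD d]) ×ˢ
        ((Finset.Ioc 0 N).filter fun j => d ∣ j)).card : ℕ) : ℚ) ≤
        N ^ 2 * (1 / ((d : ℚ) - 1) - 1 / d) + N / 3 := by
    intro d hd
    rw [Finset.mem_Ioc] at hd
    have hd3 : (3 : ℚ) ≤ d := by exact_mod_cast hd.1
    have hdpos : (0 : ℚ) < d := by linarith
    have h1 : ((((Finset.Ico M (M + N)).filter fun i => i ≡ d / 2 [MOD d]).card : ℕ) : ℚ)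
        ≤ N / d + 1 := by
      have h := Nat.Ico_filter_modEq_card M (M + N) (r := d) (by omega) (d / 2)
      have h' : ((((Finset.Ico M (M + N)).filter fun i => i ≡ d / 2 [MOD d]).card : ℤ) : ℚ)
        ≤ N / d + 1 := by
        rw [h]
        push_cast
        rw [max_le_iff]
        refine ⟨?_, by positivity⟩
        have a1 := Int.ceil_lt_add_one (((M : ℚ) + N - (d / 2 : ℕ)) / d)
        have a2 := Int.le_ceil (((M : ℚ) - (d / 2 : ℕ)) / d)
        have a3 : ((M : ℚ) + N - (d / 2 : ℕ)) / d = (M - (d / 2 : ℕ)) / d + N / d := by ring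
        push_cast at *
        linarith
      exact_mod_cast h'
    have h2 : ((((Finset.Ioc 0 N).filter fun j => d ∣ j).card : ℕ) : ℚ) ≤ N / d := by
      rw [Nat.Ioc_filter_dvd_card_eq_div]
      exact Nat.cast_div_le
    rw [Finset.card_product]
    push_cast
    calc _ ≤ ((N : ℚ) / d + 1) * (N / d) := by gcongr
      _ = N ^ 2 * (1 / ((d : ℚ) * d)) + N / d := by field_simp
      _ ≤ _ := by
        gcongr
        rw [div_sub_div _ _ (by linarith) (by linarith)]
        have : (1 * (d : ℚ) - (d - 1) * 1) = 1 := by ring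
        rw [this]
        have : (0:ℚ) < (d - 1) * d := mul_pos (by linarith) hdpos
        gcongr
        linarith
  have htel : ∀ n : ℕ, ∑ d ∈ Finset.Ioc 2 n, (1 / ((d : ℚ) - 1) - 1 / d) ≤ 1 / 2 := by
    intro n
    rcases le_or_gt n 2 with h | h
    · rw [Finset.Ioc_eq_empty (by omega)]; norm_num
    · have : ∑ d ∈ Finset.Ioc 2 n, (1 / ((d : ℚ) - 1) - 1 / d) = 1 / 2 - 1 / n := by
        induction n, h using Nat.le_induction with
        | base => simp; norm_num
        | succ k hk ih =>
          rw [Finset.sum_Ioc_succ_top (by omega), ih]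
          push_cast
          ring
      rw [this]
      have : (0 : ℚ) ≤ 1 / n := by positivity
      linarith
  have hbadle : (bad.card : ℚ) ≤ 5 / 6 * N ^ 2 := by
    calc (bad.card : ℚ) ≤ ∑ d ∈ Finset.Ioc 2 N,
          (N ^ 2 * (1 / ((d : ℚ) - 1) - 1 / d) + N / 3) := by
          refine le_trans ?_ (Finset.sum_le_sum hterm)
          exact_mod_cast (Finset.card_le_card hsub).trans Finset.card_biUnion_le
      _ = N ^ 2 * ∑ d ∈ Finset.Ioc 2 N, (1 / ((d : ℚ) - 1) - 1 / d)
          + ((N - 2 : ℕ) : ℚ) * (N / 3) := by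
          rw [Finset.sum_add_distrib, Finset.mul_sum]; simp
      _ ≤ N ^ 2 * (1 / 2) + N * (N / 3) := by
          gcongr
          · exact htel N
          · omega
      _ = _ := by ring
  have h1 : (((S.filter fun q => (2 * q.1 + 1).Coprime (2 * q.2)).card : ℕ) : ℚ) + bad.card
      = N ^ 2 := by
    exact_mod_cast hsplit.trans hcard
  have : ((N ^ 2 : ℕ) : ℚ) ≤ (6 * (S.filter fun q => (2 * q.1 + 1).Coprime (2 * q.2)).card : ℕ) := by
    push_cast
    linarith
  exact_mod_cast this

theorem finite_primitivePrincipal (K : Type*) [Field K] [NumberField K] (x : ℝ) :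
    {I : Ideal (𝓞 K) | I ≠ ⊥ ∧ Submodule.IsPrincipal I ∧ (Ideal.absNorm I : ℝ) ≤ x ∧
      ∀ n : ℤ, 2 ≤ n → ¬ I ≤ Ideal.span {(n : 𝓞 K)}}.Finite :=
  (Ideal.finite_setOfPred_absNorm_le ⌊x⌋₊).subset fun _ hI => Nat.le_floor hI.2.2.1

theorem span_add_mul_le_span_int {R : Type*} [CommRing R] {θ : R}
    (b : Module.Basis (Fin 3) ℤ R) (hb : ∀ i, b i = θ ^ (i : ℕ)) {u v n : ℤ}
    (h : Ideal.span {(u : R) + v * θ} ≤ Ideal.span {(n : R)}) : n ∣ u ∧ n ∣ v := by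
  rw [Ideal.span_singleton_le_span_singleton] at h
  obtain ⟨y, hy⟩ := h
  have h1 : u • b 0 + v • b 1 = n • y := by simp [hb, hy]
  have h2 := congrArg b.repr h1
  refine ⟨⟨b.repr y 0, ?_⟩, ⟨b.repr y 1, ?_⟩⟩
  · simpa [-zsmul_eq_mul, Finsupp.single_apply] using congrArg (fun f => f 0) h2
  · simpa [-zsmul_eq_mul, Finsupp.single_apply] using congrArg (fun f => f 1) h2

theorem add_mul_eq_zero {R : Type*} [CommRing R] {θ : R}
    (b : Module.Basis (Fin 3) ℤ R) (hb : ∀ i, b i = θ ^ (i : ℕ)) {u v : ℤ}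
    (h : (u : R) + v * θ = 0) : u = 0 ∧ v = 0 := by
  have := span_add_mul_le_span_int b hb (u := u) (v := v) (n := 0) (by simp [h])
  simpa using this

/-- The bounds on the norm form on the box used for counting. -/
theorem simplestCubicForm_bounds {a N u v : ℝ} (ha : 8 ≤ a) (hN : 1 ≤ N)
    (hu : 40 * N ≤ u) (hu' : u ≤ 44 * N) (hv : N ≤ 6 * v) (hv' : v ≤ 2 * N) :
    100 * a * N ^ 3 ≤ u ^ 3 - 3 * u * v ^ 2 + v ^ 3 + a * (u * v * (u - v)) ∧
    u ^ 3 - 3 * u * v ^ 2 + v ^ 3 + a * (u * v * (u - v)) ≤ 15625 * a * N ^ 3 := by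
  have hN3 : 0 ≤ N ^ 3 := by positivity
  have hu0 : 0 ≤ u := by linarith
  have hv0 : 0 ≤ v := by linarith
  have huv : 0 ≤ u - v := by linarith
  have e1 : (40 * N) * (N / 6) * (38 * N) ≤ u * v * (u - v) := by
    gcongr <;> linarith
  have e2 : u * v * (u - v) ≤ (44 * N) * (2 * N) * (44 * N) := by
    gcongr; linarith
  have e3 : v ^ 2 ≤ (2 * N) ^ 2 := by gcongr
  have e4 : (40 * N) ^ 2 ≤ u ^ 2 := by gcongr
  have e5 : u ^ 3 ≤ (44 * N) ^ 3 := by gcongr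
  have e6 : v ^ 3 ≤ (2 * N) ^ 3 := by gcongr
  have e7 : 0 ≤ u * (u ^ 2 - 3 * v ^ 2) := mul_nonneg hu0 (by nlinarith)
  have e8 : 0 ≤ u * v ^ 2 := by positivity
  have e9 : 0 ≤ v ^ 3 := by positivity
  have f1 := mul_le_mul_of_nonneg_left e1 (show 0 ≤ a by linarith)
  have f2 := mul_le_mul_of_nonneg_left e2 (show 0 ≤ a by linarith)
  have f3 := mul_le_mul_of_nonneg_right ha hN3
  constructor
  · have : 0 ≤ a * N ^ 3 := by positivity
    nlinarith
  · nlinarith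

theorem abs_simplestCubicForm_lt {a N s t : ℝ} (ha : 8 ≤ a) (hN : 1 ≤ N)
    (hs : |s| ≤ 2 * N) (ht : |t| ≤ 2 * N) :
    |s ^ 3 - 3 * s * t ^ 2 + t ^ 3 + a * (s * t * (s - t))| < 100 * a * N ^ 3 := by
  have hst : |s - t| ≤ 4 * N := (abs_sub s t).trans (by linarith)
  have h0 : (0 : ℝ) < N ^ 3 := by positivity
  calc |s ^ 3 - 3 * s * t ^ 2 + t ^ 3 + a * (s * t * (s - t))|
      ≤ |s| ^ 3 + 3 * |s| * |t| ^ 2 + |t| ^ 3 + a * (|s| * |t| * |s - t|) := by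
        refine (abs_add_le _ _).trans (add_le_add ((abs_add_le _ _).trans
          (add_le_add ((abs_sub _ _).trans ?_) ?_)) ?_) <;>
        simp [abs_mul, abs_of_pos (show 0 < a by linarith)]
    _ ≤ (2 * N) ^ 3 + 3 * (2 * N) * (2 * N) ^ 2 + (2 * N) ^ 3
        + a * ((2 * N) * (2 * N) * (4 * N)) := by gcongr
    _ < 100 * a * N ^ 3 := by nlinarith

theorem sq_le_ncard_primitivePrincipal {K : Type*} [Field K] [NumberField K] {a : ℤ} (ha : 8 ≤ a)
    {θ : 𝓞 K} (hθ : θ ^ 3 = a * θ ^ 2 + (a + 3) * θ + 1)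
    (b : Module.Basis (Fin 3) ℤ (𝓞 K)) (hb : ∀ i, b i = θ ^ (i : ℕ))
    {N : ℕ} (hN : 1 ≤ N) {x : ℝ} (hx : 15625 * (a : ℝ) * (N : ℝ) ^ 3 ≤ x) :
    N ^ 2 ≤ 12 * Set.ncard {I : Ideal (𝓞 K) | I ≠ ⊥ ∧ Submodule.IsPrincipal I ∧
      (Ideal.absNorm I : ℝ) ≤ x ∧ ∀ n : ℤ, 2 ≤ n → ¬ I ≤ Ideal.span {(n : 𝓞 K)}} := by
  classical
  have haR : (8 : ℝ) ≤ a := by exact_mod_cast ha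
  have hNR : (1 : ℝ) ≤ N := by exact_mod_cast hN
  set S := (Finset.Ico (20 * N) (20 * N + N)) ×ˢ (Finset.Ioc 0 N)
  set C := S.filter fun q => (2 * q.1 + 1).Coprime (2 * q.2) with hC
  set T := C.filter fun q => N < 12 * q.2 with hT
  have hTcard : N ^ 2 ≤ 12 * T.card := by
    have h1 : N ^ 2 ≤ 6 * C.card := card_coprime_odd_even_ge (20 * N) N
    have h2 := Finset.card_filter_add_card_filter_not (s := C) (fun q : ℕ × ℕ => N < 12 * q.2)
    have h3 : (C.filter fun q => ¬ N < 12 * q.2).card ≤ N * (N / 12) := by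
      have hsub : (C.filter fun q => ¬ N < 12 * q.2) ⊆
          (Finset.Ico (20 * N) (20 * N + N)) ×ˢ (Finset.Ioc 0 (N / 12)) := by
        rintro ⟨i, j⟩ h
        simp only [hC, S, Finset.mem_filter, Finset.mem_product, Finset.mem_Ioc] at h ⊢
        exact ⟨h.1.1.1, h.1.1.2.1, by omega⟩
      simpa using Finset.card_le_card hsub
    have h4 : N * (N / 12) * 12 ≤ N * N := by
      rw [mul_assoc]
      exact Nat.mul_le_mul_left _ (Nat.div_mul_le_self N 12)
    rw [← hT] at h2
    nlinarith
  set g : ℕ × ℕ → 𝓞 K := fun q => ((2 * q.1 + 1 : ℤ) : 𝓞 K) + (2 * q.2 : ℤ) * θ with hg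
  have hmem : ∀ q ∈ T, 20 * N ≤ q.1 ∧ q.1 < 21 * N ∧ q.2 ≤ N ∧ N < 12 * q.2 ∧
      (2 * q.1 + 1).Coprime (2 * q.2) := by
    intro q hq
    simp only [hT, hC, S, Finset.mem_filter, Finset.mem_product, Finset.mem_Ico,
      Finset.mem_Ioc] at hq
    exact ⟨hq.1.1.1.1, by omega, hq.1.1.2.2, hq.2, hq.1.2⟩
  have hnorm : ∀ q ∈ T, 100 * (a : ℝ) * (N : ℝ) ^ 3 ≤ (Algebra.norm ℤ (g q) : ℝ) ∧
      (Algebra.norm ℤ (g q) : ℝ) ≤ 15625 * a * (N : ℝ) ^ 3 := by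
    intro q hq
    obtain ⟨h1, h2, h3, h4, -⟩ := hmem q hq
    rw [hg, simplestCubic_norm hθ b hb]
    push_cast
    have h1' : (20 : ℝ) * N ≤ q.1 := by exact_mod_cast h1
    have h2' : (q.1 : ℝ) ≤ 21 * N := by exact_mod_cast h2.le
    have h3' : (q.2 : ℝ) ≤ N := by exact_mod_cast h3
    have h4' : (N : ℝ) ≤ 12 * q.2 := by exact_mod_cast h4.le
    exact simplestCubicForm_bounds haR hNR (by linarith) (by linarith) (by linarith) (by linarith)
  have hinj : Set.InjOn (fun q => Ideal.span {g q}) (T : Set (ℕ × ℕ)) := by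
    intro q hq r hr hqr
    obtain ⟨h1, h2, h3, h4, -⟩ := hmem q hq
    obtain ⟨k1, k2, k3, k4, -⟩ := hmem r hr
    have hdvd : g q ∣ g q - g r :=
      dvd_sub dvd_rfl (Ideal.span_singleton_le_span_singleton.1 (le_of_eq hqr.symm))
    have hsub : g q - g r = ((2 * (q.1 - r.1) : ℤ) : 𝓞 K) + (2 * (q.2 - r.2) : ℤ) * θ := by
      simp only [hg]; push_cast; ring
    have hlt : |(Algebra.norm ℤ (g q - g r) : ℝ)| < Algebra.norm ℤ (g q) := by
      refine lt_of_lt_of_le ?_ (hnorm q hq).1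
      rw [hsub, simplestCubic_norm hθ b hb]
      push_cast
      apply abs_simplestCubicForm_lt haR hNR
      · have h : |(2 * (q.1 - r.1) : ℤ)| ≤ 2 * N := by rw [abs_le]; omega
        simpa using (Int.cast_le (R := ℝ)).2 h
      · have h : |(2 * (q.2 - r.2) : ℤ)| ≤ 2 * N := by rw [abs_le]; omega
        simpa using (Int.cast_le (R := ℝ)).2 h
    have hzero : Algebra.norm ℤ (g q - g r) = 0 :=
      Int.eq_zero_of_abs_lt_dvd (map_dvd (Algebra.norm ℤ) hdvd) (by exact_mod_cast hlt)
    have hz : g q - g r = 0 := (Algebra.norm_eq_zero_iff_of_basis b).1 hzero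
    obtain ⟨e1, e2⟩ := add_mul_eq_zero b hb (hsub ▸ hz)
    exact Prod.ext (by omega) (by omega)
  refine hTcard.trans (Nat.mul_le_mul_left _ ?_)
  rw [← Set.ncard_coe_finset, ← hinj.ncard_image]
  refine Set.ncard_le_ncard ?_ (finite_primitivePrincipal K x)
  rintro _ ⟨q, hq, rfl⟩
  obtain ⟨hlo, hhi⟩ := hnorm q hq
  have hpos : (0 : ℝ) < (Algebra.norm ℤ (g q) : ℝ) := lt_of_lt_of_le (by positivity) hlo
  refine ⟨?_, ⟨⟨g q, rfl⟩⟩, ?_, ?_⟩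
  · rw [Ne, Ideal.span_singleton_eq_bot]
    intro h0
    rw [h0, (Algebra.norm_eq_zero_iff_of_basis b).2 rfl] at hpos
    simp at hpos
  · rw [Ideal.absNorm_span_singleton, Nat.cast_natAbs, Int.cast_abs, abs_of_pos hpos]
    exact hhi.trans hx
  · intro n hn hle
    obtain ⟨d1, d2⟩ := span_add_mul_le_span_int b hb hle
    have hcop : IsCoprime (2 * q.1 + 1 : ℤ) (2 * q.2 : ℤ) := by
      exact_mod_cast Nat.isCoprime_iff_coprime.2 (hmem q hq).2.2.2.2
    rcases Int.isUnit_iff.1 (hcop.isUnit_of_dvd' d1 d2) with h | h <;> omega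

theorem one_le_ncard_primitivePrincipal {K : Type*} [Field K] [NumberField K] {θ : 𝓞 K}
    (b : Module.Basis (Fin 3) ℤ (𝓞 K)) (hb : ∀ i, b i = θ ^ (i : ℕ)) {x : ℝ} (hx : 1 ≤ x) :
    1 ≤ Set.ncard {I : Ideal (𝓞 K) | I ≠ ⊥ ∧ Submodule.IsPrincipal I ∧
      (Ideal.absNorm I : ℝ) ≤ x ∧ ∀ n : ℤ, 2 ≤ n → ¬ I ≤ Ideal.span {(n : 𝓞 K)}} := by
  rw [Nat.one_le_iff_ne_zero, ← Nat.pos_iff_ne_zero,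
    Set.ncard_pos (finite_primitivePrincipal K x)]
  refine ⟨⊤, top_ne_bot, ⟨⟨1, by simp⟩⟩, by simpa using hx, fun n hn hle => ?_⟩
  have h := (span_add_mul_le_span_int b hb (u := 1) (v := 0) (by simpa using hle)).1
  have := Int.le_of_dvd one_pos h
  omega

theorem stmt_18 :
    ∃ c : ℝ, 0 < c ∧
      ∀ (a : ℤ), 8 ≤ a →
      ∀ (K : Type) [Field K] [NumberField K] (σ : K →+* ℝ) (ρK : K),
        σ ρK = simplestCubicRoot a →
        IntermediateField.adjoin ℚ {ρK} = ⊤ →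
        Algebra.adjoin ℤ {ρK} = integralClosure ℤ K →
        ∀ x : ℝ, 125 * (a : ℝ) ≤ x →
          c * (x / a) ^ ((2 : ℝ) / 3) ≤
            (Set.ncard {I : Ideal (RingOfIntegers K) |
                I ≠ ⊥ ∧ Submodule.IsPrincipal I ∧ (Ideal.absNorm I : ℝ) ≤ x ∧
                ∀ n : ℤ, 2 ≤ n → ¬ I ≤ Ideal.span {(n : RingOfIntegers K)}} : ℝ) := by
  refine ⟨1 / 30000, by norm_num, ?_⟩
  intro a ha K _ _ σ ρK hσ _ hadj x hx
  obtain ⟨θ, b, hθ, hb⟩ := exists_simplestCubic_basis (by omega) σ hσ hadj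
  have haR : (8 : ℝ) ≤ a := by exact_mod_cast ha
  have hy0 : 0 ≤ x / a := div_nonneg (by linarith) (by linarith)
  set z : ℝ := (x / a) ^ ((1 : ℝ) / 3) with hz
  have hz0 : 0 ≤ z := Real.rpow_nonneg hy0 _
  have hz2 : (x / a) ^ ((2 : ℝ) / 3) = z ^ 2 := by
    rw [hz, ← Real.rpow_natCast, ← Real.rpow_mul hy0]; norm_num
  have hz3 : z ^ 3 = x / a := by
    rw [hz, ← Real.rpow_natCast, ← Real.rpow_mul hy0]; norm_num
  have hx' : a * z ^ 3 = x := by rw [hz3]; field_simp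
  rw [hz2]
  rcases lt_or_ge z 25 with h | h
  · have h1 := one_le_ncard_primitivePrincipal b hb (x := x) (by linarith)
    refine le_trans ?_ (Nat.one_le_cast.2 h1)
    nlinarith
  · have hN1 : 1 ≤ ⌊z / 25⌋₊ := Nat.le_floor (by push_cast; linarith)
    have hNle : (⌊z / 25⌋₊ : ℝ) ≤ z / 25 := Nat.floor_le (by positivity)
    have hNlt := Nat.lt_floor_add_one (z / 25)
    set N := ⌊z / 25⌋₊
    have hN1' : (1 : ℝ) ≤ N := by exact_mod_cast hN1
    have h1 := sq_le_ncard_primitivePrincipal ha hθ b hb hN1 (x := x) (by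
      have : (N : ℝ) ^ 3 ≤ (z / 25) ^ 3 := by gcongr
      have := mul_le_mul_of_nonneg_left this (show (0 : ℝ) ≤ 15625 * a by linarith)
      rw [← hx']
      linarith)
    have h1' := Nat.cast_le (α := ℝ).2 h1
    push_cast at h1'
    have h2 : (z / 50) ^ 2 ≤ (N : ℝ) ^ 2 := by
      gcongr
      linarith
    linarith
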